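/- arXiv:2007.01463 — 3 statements merged into one kernel-verified Lean document; each statement's English description precedes it below -/
import Mathlib

section
/- Let ρ > 0 and k ∈ [0,1]. Define p(0,0) = (2ρ + kρ + 2)/((ρ + 1)(k²ρ² + 2kρ² + 3kρ + ρ² + 2ρ + 2)), p(1,0) = ρ(ρ + kρ + 2)/(2ρ + kρ + 2) · p(0,0), p(0,1) = ρ²(ρ + kρ + 2)/((ρ + 2)(2ρ + kρ + 2)) · p(0,0), p(0,2) = kρ(6ρ + 2kρ + kρ² + ρ² + 4)/((ρ + 2)(2ρ + kρ + 2)) · p(0,0), p(1,1) = ρ²(ρ + 1)(ρ + kρ + 2)/((ρ + 2)(2ρ + kρ + 2)) · p(0,0), p(1,2) = kρ²(5ρ + 2kρ + kρ² + ρ² + 4)/((ρ + 2)(2ρ + kρ + 2)) · p(0,0). Then all p(m,n) are nonnegative, they sum to 1, and they satisfy the partial flexibility balance equations with γ = 1; i.e., p is the stationary distribution of the partial flexibility system with identical service times. -/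
/-- The balance equations of the partial flexibility system with parameters `ρ`, `k`, `γ`. -/
def PartialBalance (ρ k γ : ℝ) (p : Fin 2 → Fin 3 → ℝ) : Prop :=
  (ρ + k*ρ) * p 0 0 = p 1 0 + γ * p 0 1 + p 0 2 ∧
  (ρ + k*ρ + 1) * p 1 0 = ρ * p 0 0 + γ * p 1 1 + p 1 2 ∧
  2 * p 1 2 = ρ * p 0 2 + k*ρ * p 1 0 ∧
  (ρ + 1) * p 0 2 = k*ρ * p 0 0 + p 1 2 ∧
  (1 + γ) * p 1 1 = ρ * (p 0 1 + p 1 0) ∧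
  (ρ + γ) * p 0 1 = p 1 1

/-- `p` is a stationary distribution of the partial flexibility system. -/
def PartialStationary (ρ k γ : ℝ) (p : Fin 2 → Fin 3 → ℝ) : Prop :=
  (∀ m n, 0 ≤ p m n) ∧ (∑ m : Fin 2, ∑ n : Fin 3, p m n) = 1 ∧ PartialBalance ρ k γ p

/-- Throughput of the partial flexibility system. -/
noncomputable def Tps (ρ k : ℝ) (p : Fin 2 → Fin 3 → ℝ) : ℝ :=
  ρ * (1 - p 1 1 - p 1 2) + k*ρ * (1 - p 1 1 - p 1 2 - p 0 1 - p 0 2)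

/-- the given family `p` is the stationary distribution of the partial
flexibility system with identical service times (`γ = 1`). -/
theorem stmt_1 (ρ k : ℝ) (hρ : 0 < ρ) (hk : k ∈ Set.Icc (0:ℝ) 1) :
    PartialStationary ρ k 1
      (![![(2*ρ + k*ρ + 2)/((ρ + 1)*(k^2*ρ^2 + 2*k*ρ^2 + 3*k*ρ + ρ^2 + 2*ρ + 2)),
          ρ^2*(ρ + k*ρ + 2)/((ρ + 2)*(2*ρ + k*ρ + 2)) *
            ((2*ρ + k*ρ + 2)/((ρ + 1)*(k^2*ρ^2 + 2*k*ρ^2 + 3*k*ρ + ρ^2 + 2*ρ + 2))),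
          k*ρ*(6*ρ + 2*k*ρ + k*ρ^2 + ρ^2 + 4)/((ρ + 2)*(2*ρ + k*ρ + 2)) *
            ((2*ρ + k*ρ + 2)/((ρ + 1)*(k^2*ρ^2 + 2*k*ρ^2 + 3*k*ρ + ρ^2 + 2*ρ + 2)))],
        ![ρ*(ρ + k*ρ + 2)/(2*ρ + k*ρ + 2) *
            ((2*ρ + k*ρ + 2)/((ρ + 1)*(k^2*ρ^2 + 2*k*ρ^2 + 3*k*ρ + ρ^2 + 2*ρ + 2))),
          ρ^2*(ρ + 1)*(ρ + k*ρ + 2)/((ρ + 2)*(2*ρ + k*ρ + 2)) *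
            ((2*ρ + k*ρ + 2)/((ρ + 1)*(k^2*ρ^2 + 2*k*ρ^2 + 3*k*ρ + ρ^2 + 2*ρ + 2))),
          k*ρ^2*(5*ρ + 2*k*ρ + k*ρ^2 + ρ^2 + 4)/((ρ + 2)*(2*ρ + k*ρ + 2)) *
            ((2*ρ + k*ρ + 2)/((ρ + 1)*(k^2*ρ^2 + 2*k*ρ^2 + 3*k*ρ + ρ^2 + 2*ρ + 2)))]]) := by
  obtain ⟨hk, -⟩ := hk
  have hN : 2*ρ + k*ρ + 2 ≠ 0 := by positivity
  have hD : k^2*ρ^2 + 2*k*ρ^2 + 3*k*ρ + ρ^2 + 2*ρ + 2 ≠ 0 := by positivity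
  refine ⟨?_, ?_, ?_, ?_, ?_, ?_, ?_, ?_⟩
  · intro m n
    fin_cases m <;> fin_cases n <;> dsimp <;> positivity
  · simp only [Fin.sum_univ_two, Fin.sum_univ_three]
    dsimp
    field_simp
    ring
  · dsimp
    field_simp
    ring
  · dsimp
    field_simp
    ring
  · dsimp
    field_simp
    ring
  · dsimp
    field_simp
    ring
  · dsimp
    field_simp
    ring
  · dsimp
    field_simp
end

section
/- Let ρ > 0 and k ∈ (0,1). There exists exactly one γ ∈ (0,1) with the following property: there exist a stationary distribution π of the full flexibility system and a stationary distribution p of the partial flexibility system, both with parameters (ρ, k, γ), such that T_fs(π) = T_ps(p). (This unique value is denoted γ^r.) -/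
/-- The balance equations of the full flexibility system with parameters `ρ`, `k`, `γ`. -/
def FullBalance (ρ k γ : ℝ) (π : Fin 3 → Fin 3 → ℝ) : Prop :=
  (ρ + k*ρ) * π 0 0 = π 1 0 + γ * π 0 1 + π 0 2 + γ * π 2 0 ∧
  (ρ + k*ρ + 1) * π 1 0 = ρ * π 0 0 + γ * π 1 1 + π 1 2 ∧
  (ρ + k*ρ + γ) * π 2 0 = γ * π 2 1 + π 2 2 ∧
  (ρ + k*ρ + γ) * π 0 1 = π 1 1 + γ * π 2 1 ∧
  (1 + γ) * π 1 1 = ρ * π 1 0 + ρ * π 0 1 ∧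
  2 * γ * π 2 1 = ρ * π 2 0 + k*ρ * π 0 1 ∧
  (ρ + k*ρ + 1) * π 0 2 = k*ρ * π 0 0 + π 1 2 + γ * π 2 2 ∧
  2 * π 1 2 = ρ * π 0 2 + k*ρ * π 1 0 ∧
  (γ + 1) * π 2 2 = k*ρ * π 2 0 + k*ρ * π 0 2

/-- `π` is a stationary distribution of the full flexibility system. -/
def FullStationary (ρ k γ : ℝ) (π : Fin 3 → Fin 3 → ℝ) : Prop :=
  (∀ i j, 0 ≤ π i j) ∧ (∑ i : Fin 3, ∑ j : Fin 3, π i j) = 1 ∧ FullBalance ρ k γ π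

/-- Throughput of the full flexibility system. -/
noncomputable def Tfs (ρ k : ℝ) (π : Fin 3 → Fin 3 → ℝ) : ℝ :=
  (k + 1) * ρ * (1 - π 1 1 - π 1 2 - π 2 1 - π 2 2)

/-- Throughput of the independent system. -/
noncomputable def Tis (ρ k : ℝ) : ℝ := ρ/(ρ+1) + k*ρ/(k*ρ+1)


open Set

/-! ### Normalising solutions of balance equations -/

/-- A family of total mass one proportional to `w` is `w` divided by the total mass of `w`. -/
lemma mul_sum_eq_of_proportional {m n : ℕ} {π w : Fin m → Fin n → ℝ} {i₀ : Fin m} {j₀ : Fin n}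
    (hw : w i₀ j₀ ≠ 0) (h : ∀ i j, π i j * w i₀ j₀ = π i₀ j₀ * w i j)
    (hπ : ∑ i, ∑ j, π i j = 1) (i : Fin m) (j : Fin n) :
    π i j * ∑ i, ∑ j, w i j = w i j := by
  have hsum : w i₀ j₀ = π i₀ j₀ * ∑ i, ∑ j, w i j := by
    calc w i₀ j₀ = (∑ i, ∑ j, π i j) * w i₀ j₀ := by rw [hπ, one_mul]
      _ = ∑ i, ∑ j, π i j * w i₀ j₀ := by simp only [Finset.sum_mul]
      _ = π i₀ j₀ * ∑ i, ∑ j, w i j := by simp only [h, Finset.mul_sum]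
  refine mul_right_cancel₀ hw ?_
  linear_combination (∑ i, ∑ j, w i j) * h i j - w i j * hsum

/-! ### The full flexibility system -/

/-- Unnormalised weight of the empty state of the full flexibility system, divided by `γ`. -/
def fullEmptyFactor (a b g : ℝ) : ℝ :=
  2*(1 + g)*(a + b)^3 + 5*(1 + g)^2*(a^2 + b^2) + (6*g^2 + 28*g + 6)*a*b
    + 2*(1 + g)*(g^2 + 6*g + 1)*(a + b) + 4*g*(1 + g)^2

/-- Unnormalised weight of the state with only Server 1 busy, with its own customer type,
divided by `γ` and the arrival rate of that type. -/
def fullDedicatedFactor (a b g : ℝ) : ℝ :=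
  (1 + g)*(a + b)^3 + 3*(1 + g)^2*a^2 + (6*g^2 + 18*g + 4)*a*b + (1 + g)*(3*g + 5)*b^2
    + 2*(1 + g)*(g^2 + 4*g + 1)*a + 2*(1 + g)*(g^2 + 6*g + 1)*b + 4*g*(1 + g)^2

/-- Unnormalised weight of the state with only Server 1 busy, with the other customer type,
divided by the arrival rate of that type. -/
def fullOverflowFactor (a b g : ℝ) : ℝ :=
  (1 + g)*(a + b)^3 + 2*(1 + g)*a^2 + (2*g^2 + 10*g)*a*b + 2*(1 + g)^2*b^2 + 4*g*(1 + g)*b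

/-- An unnormalised stationary solution of the full flexibility system with arrival rates
`a` and `b`. -/
noncomputable def fullWeight (a b g : ℝ) : Fin 3 → Fin 3 → ℝ :=
  let w10 := a*g*fullDedicatedFactor a b g
  let w02 := b*g*fullDedicatedFactor b a g
  let w20 := b*fullOverflowFactor a b g
  let w01 := a*fullOverflowFactor b a g
  ![![g*fullEmptyFactor a b g, w01, w02],
    ![w10, a*(w10 + w01)/(1 + g), (a*w02 + b*w10)/2],
    ![w20, (a*w20 + b*w01)/(2*g), b*(w20 + w02)/(1 + g)]]

lemma fullWeight_pos {a b g : ℝ} (ha : 0 < a) (hb : 0 < b) (hg : 0 < g) (i j : Fin 3) :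
    0 < fullWeight a b g i j := by
  have h₁ : 0 < fullEmptyFactor a b g := by unfold fullEmptyFactor; positivity
  have h₂ {x y : ℝ} (hx : 0 < x) (hy : 0 < y) : 0 < fullDedicatedFactor x y g := by
    unfold fullDedicatedFactor; positivity
  have h₃ {x y : ℝ} (hx : 0 < x) (hy : 0 < y) : 0 < fullOverflowFactor x y g := by
    unfold fullOverflowFactor; positivity
  have := h₂ ha hb
  have := h₂ hb ha
  have := h₃ ha hb
  have := h₃ hb ha
  fin_cases i <;> fin_cases j <;> simp [fullWeight] <;> positivity

lemma fullBalance_smul_fullWeight {ρ k g : ℝ} (hg : 0 < g) (c : ℝ) :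
    FullBalance ρ k g (fun i j => c * fullWeight ρ (k*ρ) g i j) := by
  have hg₁ : 1 + g ≠ 0 := by positivity
  refine ⟨?_, ?_, ?_, ?_, ?_, ?_, ?_, ?_, ?_⟩ <;>
    simp [fullWeight, fullEmptyFactor, fullDedicatedFactor, fullOverflowFactor] <;>
    field_simp <;> ring

/-- Elimination for the states with a single busy server in the full flexibility system. -/
lemma full_single_server_eq {a b g x00 x10 x20 x01 x02 : ℝ} (hg : 0 < g)
    (h10 : (2*(1 + g)*(a + b + 1) - 2*g*a - b*(1 + g))*x10 - 2*g*a*x01 - a*(1 + g)*x02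
      = 2*(1 + g)*a*x00)
    (h20 : (2*(1 + g)*(a + b + g) - a*(1 + g) - 2*b)*x20 - b*(1 + g)*x01 - 2*b*x02 = 0)
    (h01 : (2*(1 + g)*(a + b + g) - 2*a - b*(1 + g))*x01 - 2*a*x10 - a*(1 + g)*x20 = 0)
    (h02 : (2*(1 + g)*(a + b + 1) - a*(1 + g) - 2*g*b)*x02 - b*(1 + g)*x10 - 2*g*b*x20
      = 2*(1 + g)*b*x00) :
    x10*fullEmptyFactor a b g = a*fullDedicatedFactor a b g*x00 ∧
      x20*(g*fullEmptyFactor a b g) = b*fullOverflowFactor a b g*x00 := by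
  have hg₁ : 2*(1 + g) ≠ 0 := by positivity
  unfold fullEmptyFactor fullDedicatedFactor fullOverflowFactor
  constructor
  · refine mul_left_cancel₀ hg₁ ?_
    linear_combination
      (a^3*g + a^3 + 2*a^2*b*g + 2*a^2*b + 3*a^2*g^2 + 6*a^2*g + 3*a^2 + a*b^2*g + a*b^2
        + 3*a*b*g^2 + 14*a*b*g + 3*a*b + 2*a*g^3 + 10*a*g^2 + 10*a*g + 2*a + 4*b^2*g + 4*b^2
        + 10*b*g^2 + 12*b*g + 2*b + 4*g^3 + 8*g^2 + 4*g)*h10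
      + (a*(1 + g)*(a^2 + 2*a*b + 2*a + b^2 + 2*b*g))*h20
      + (a*(a^2*g + a^2 + 2*a*b*g + 2*a*b + 2*a*g^2 + 4*a*g + 2*a + b^2*g + b^2 + 8*b*g + 4*g^2
        + 4*g))*h01
      + (a*(1 + g)*(a + b + 2*g)*(a + b + g + 1))*h02
  · refine mul_left_cancel₀ hg₁ ?_
    linear_combination
      (b*(1 + g)*(a^2 + 2*a*b + 2*a + b^2 + 2*b*g))*h10
      + (a^2*b*g + a^2*b + 4*a^2*g^2 + 4*a^2*g + 2*a*b^2*g + 2*a*b^2 + 3*a*b*g^2 + 14*a*b*g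
        + 3*a*b + 2*a*g^3 + 12*a*g^2 + 10*a*g + b^3*g + b^3 + 3*b^2*g^2 + 6*b^2*g + 3*b^2
        + 2*b*g^3 + 10*b*g^2 + 10*b*g + 2*b + 4*g^3 + 8*g^2 + 4*g)*h20
      + (b*(1 + g)*(a + b + 2)*(a + b + g + 1))*h01
      + (b*(a^2*g + a^2 + 2*a*b*g + 2*a*b + 8*a*g + b^2*g + b^2 + 2*b*g^2 + 4*b*g + 2*b + 4*g^2
        + 4*g))*h02

lemma FullBalance.mul_fullWeight {ρ k g : ℝ} {π : Fin 3 → Fin 3 → ℝ} (hg : 0 < g)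
    (h : FullBalance ρ k g π) (i j : Fin 3) :
    π i j * fullWeight ρ (k*ρ) g 0 0 = π 0 0 * fullWeight ρ (k*ρ) g i j := by
  obtain ⟨-, e10, e20, e01, e11, e21, e02, e12, e22⟩ := h
  have hg₁ : 1 + g ≠ 0 := by positivity
  obtain ⟨r10, r20⟩ := full_single_server_eq (a := ρ) (b := k*ρ) (x00 := π 0 0) (x10 := π 1 0)
    (x20 := π 2 0) (x01 := π 0 1) (x02 := π 0 2) hg
    (by linear_combination 2*(1 + g)*e10 + 2*g*e11 + (1 + g)*e12)
    (by linear_combination 2*(1 + g)*e20 + (1 + g)*e21 + 2*e22)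
    (by linear_combination 2*(1 + g)*e01 + (1 + g)*e21 + 2*e11)
    (by linear_combination 2*(1 + g)*e02 + (1 + g)*e12 + 2*g*e22)
  obtain ⟨r02, r01⟩ := full_single_server_eq (a := k*ρ) (b := ρ) (x00 := π 0 0) (x10 := π 0 2)
    (x20 := π 0 1) (x01 := π 2 0) (x02 := π 1 0) hg
    (by linear_combination 2*(1 + g)*e02 + (1 + g)*e12 + 2*g*e22)
    (by linear_combination 2*(1 + g)*e01 + (1 + g)*e21 + 2*e11)
    (by linear_combination 2*(1 + g)*e20 + (1 + g)*e21 + 2*e22)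
    (by linear_combination 2*(1 + g)*e10 + 2*g*e11 + (1 + g)*e12)
  have hswap : fullEmptyFactor (k*ρ) ρ g = fullEmptyFactor ρ (k*ρ) g := by
    unfold fullEmptyFactor; ring
  rw [hswap] at r02 r01
  fin_cases i <;> fin_cases j <;> simp [fullWeight]
  · linear_combination r01
  · linear_combination g*r02
  · linear_combination g*r10
  · field_simp
    linear_combination g*fullEmptyFactor ρ (k*ρ) g*e11 + ρ*g*r10 + ρ*r01
  · field_simp
    linear_combination fullEmptyFactor ρ (k*ρ) g*e12 + ρ*r02 + k*ρ*r10
  · linear_combination r20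
  · field_simp
    linear_combination g*fullEmptyFactor ρ (k*ρ) g*e21 + ρ*r20 + k*ρ*r01
  · field_simp
    linear_combination g*fullEmptyFactor ρ (k*ρ) g*e22 + k*ρ*r20 + k*ρ*g*r02

lemma FullStationary.mul_sum_fullWeight {ρ k g : ℝ} {π : Fin 3 → Fin 3 → ℝ} (hρ : 0 < ρ)
    (hk : 0 < k) (hg : 0 < g) (h : FullStationary ρ k g π) (i j : Fin 3) :
    π i j * ∑ i, ∑ j, fullWeight ρ (k*ρ) g i j = fullWeight ρ (k*ρ) g i j :=
  mul_sum_eq_of_proportional (fullWeight_pos hρ (by positivity) hg 0 0).ne'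
    (h.2.2.mul_fullWeight hg) h.2.1 i j

lemma sum_fullWeight_pos {a b g : ℝ} (ha : 0 < a) (hb : 0 < b) (hg : 0 < g) :
    0 < ∑ i, ∑ j, fullWeight a b g i j :=
  Finset.sum_pos (fun i _ => Finset.sum_pos (fun j _ => fullWeight_pos ha hb hg i j) ⟨0, by simp⟩)
    ⟨0, by simp⟩

lemma exists_fullStationary {ρ k g : ℝ} (hρ : 0 < ρ) (hk : 0 < k) (hg : 0 < g) :
    ∃ π, FullStationary ρ k g π := by
  have hW := sum_fullWeight_pos hρ (mul_pos hk hρ) hg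
  refine ⟨fun i j => (∑ i, ∑ j, fullWeight ρ (k*ρ) g i j)⁻¹ * fullWeight ρ (k*ρ) g i j,
    fun i j => ?_, ?_, fullBalance_smul_fullWeight hg _⟩
  · exact mul_nonneg (inv_pos.2 hW).le (fullWeight_pos hρ (mul_pos hk hρ) hg i j).le
  · simp only [← Finset.mul_sum]
    exact inv_mul_cancel₀ hW.ne'

/-! ### The partial flexibility system -/

/-- An unnormalised stationary solution of the partial flexibility system with arrival rates
`a` and `b`. -/
def partialWeight (a b g : ℝ) : Fin 2 → Fin 3 → ℝ :=
  ![![g*(2*a^2 + a*b + a*g + 5*a + b*g + b + 2*g + 2), a^2*(a + b + 2),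
      b*g*(a^2 + a*b + a*g + 5*a + b*g + b + 2*g + 2)],
    ![a*g*(a + b + 2)*(a + g + 1), a^2*(a + g)*(a + b + 2),
      a*b*g*(a^2 + a*b + a*g + 4*a + b*g + b + 2*g + 2)]]

lemma partialWeight_pos {a b g : ℝ} (ha : 0 < a) (hb : 0 < b) (hg : 0 < g) (m : Fin 2)
    (n : Fin 3) : 0 < partialWeight a b g m n := by
  fin_cases m <;> fin_cases n <;> simp [partialWeight] <;> positivity

lemma partialBalance_smul_partialWeight (ρ k g c : ℝ) :
    PartialBalance ρ k g (fun m n => c * partialWeight ρ (k*ρ) g m n) := by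
  refine ⟨?_, ?_, ?_, ?_, ?_, ?_⟩ <;> simp [partialWeight] <;> ring

lemma PartialBalance.mul_partialWeight {ρ k g : ℝ} {p : Fin 2 → Fin 3 → ℝ} (hρ : 0 < ρ)
    (hk : 0 < k) (hg : 0 < g) (h : PartialBalance ρ k g p) (m : Fin 2) (n : Fin 3) :
    p m n * partialWeight ρ (k*ρ) g 0 0 = p 0 0 * partialWeight ρ (k*ρ) g m n := by
  obtain ⟨e00, -, e12, e02, e11, e01⟩ := h
  set b := k*ρ with hb
  have hb0 : 0 < b := by positivity
  have r01 : g*(ρ + g + 1)*p 0 1 = ρ*p 1 0 := by linear_combination e11 + (1 + g)*e01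
  have r02 : (ρ + 2)*p 0 2 = 2*b*p 0 0 + b*p 1 0 := by linear_combination e12 + 2*e02
  have r10 : p 1 0*(2*ρ^2 + ρ*b + ρ*g + 5*ρ + b*g + b + 2*g + 2)
      = p 0 0*(ρ*(ρ + b + 2)*(ρ + g + 1)) := by
    linear_combination (-(ρ + 2)*(ρ + g + 1))*e00 - (ρ + 2)*r01 - (ρ + g + 1)*r02
  have s01 : p 0 1*(g*(2*ρ^2 + ρ*b + ρ*g + 5*ρ + b*g + b + 2*g + 2))
      = p 0 0*(ρ^2*(ρ + b + 2)) := by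
    refine mul_left_cancel₀ (show ρ + g + 1 ≠ 0 by positivity) ?_
    linear_combination (2*ρ^2 + ρ*b + ρ*g + 5*ρ + b*g + b + 2*g + 2)*r01 + ρ*r10
  have s02 : p 0 2*(2*ρ^2 + ρ*b + ρ*g + 5*ρ + b*g + b + 2*g + 2)
      = p 0 0*(b*(ρ^2 + ρ*b + ρ*g + 5*ρ + b*g + b + 2*g + 2)) := by
    refine mul_left_cancel₀ (show ρ + 2 ≠ 0 by positivity) ?_
    linear_combination (2*ρ^2 + ρ*b + ρ*g + 5*ρ + b*g + b + 2*g + 2)*r02 + b*r10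
  fin_cases m <;> fin_cases n <;> simp [partialWeight]
  · linear_combination s01
  · linear_combination g*s02
  · linear_combination g*r10
  · linear_combination (ρ + g)*s01
      - g*(2*ρ^2 + ρ*b + ρ*g + 5*ρ + b*g + b + 2*g + 2)*e01
  · refine mul_left_cancel₀ (two_ne_zero (α := ℝ)) ?_
    linear_combination g*(2*ρ^2 + ρ*b + ρ*g + 5*ρ + b*g + b + 2*g + 2)*e12
      + ρ*g*s02 + b*g*r10

lemma PartialStationary.mul_sum_partialWeight {ρ k g : ℝ} {p : Fin 2 → Fin 3 → ℝ} (hρ : 0 < ρ)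
    (hk : 0 < k) (hg : 0 < g) (h : PartialStationary ρ k g p) (m : Fin 2) (n : Fin 3) :
    p m n * ∑ m, ∑ n, partialWeight ρ (k*ρ) g m n = partialWeight ρ (k*ρ) g m n :=
  mul_sum_eq_of_proportional (partialWeight_pos hρ (by positivity) hg 0 0).ne'
    (h.2.2.mul_partialWeight hρ hk hg) h.2.1 m n

lemma sum_partialWeight_pos {a b g : ℝ} (ha : 0 < a) (hb : 0 < b) (hg : 0 < g) :
    0 < ∑ m, ∑ n, partialWeight a b g m n :=
  Finset.sum_pos
    (fun m _ => Finset.sum_pos (fun n _ => partialWeight_pos ha hb hg m n) ⟨0, by simp⟩)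
    ⟨0, by simp⟩

lemma exists_partialStationary {ρ k g : ℝ} (hρ : 0 < ρ) (hk : 0 < k) (hg : 0 < g) :
    ∃ p, PartialStationary ρ k g p := by
  have hW := sum_partialWeight_pos hρ (mul_pos hk hρ) hg
  refine ⟨fun m n => (∑ m, ∑ n, partialWeight ρ (k*ρ) g m n)⁻¹ * partialWeight ρ (k*ρ) g m n,
    fun m n => ?_, ?_, partialBalance_smul_partialWeight ρ k g _⟩
  · exact mul_nonneg (inv_pos.2 hW).le (partialWeight_pos hρ (mul_pos hk hρ) hg m n).le
  · simp only [← Finset.mul_sum]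
    exact inv_mul_cancel₀ hW.ne'

/-! ### The crossing polynomial -/

/-- Coefficient of `γ^0` in the crossing polynomial, negated. -/
def crossingCoeff0 (a b : ℝ) : ℝ :=
  a^4*(a + b + 2)*(
    a^3 + 3*a^2*b + 2*a^2 + 3*a*b^2 + b^3 + 2*b^2)

/-- Coefficient of `γ^1` in the crossing polynomial, negated. -/
def crossingCoeff1 (a b : ℝ) : ℝ :=
  a*(
    2*a^6*b + 3*a^6 + 8*a^5*b^2 + 31*a^5*b + 13*a^5 + 12*a^4*b^3 + 53*a^4*b^2 + 67*a^4*b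
    + 16*a^4 + 8*a^3*b^4 + 43*a^3*b^3 + 52*a^3*b^2 + 28*a^3*b + 4*a^3 + 2*a^2*b^5 + 20*a^2*b^4
    + 52*a^2*b^3 + 24*a^2*b^2 + 4*a^2*b + 2*a*b^5 + 15*a*b^4 + 24*a*b^3 + 4*a*b^2 + b^5
    + 4*b^4 + 4*b^3)

/-- Coefficient of `γ^2` in the crossing polynomial. -/
def crossingCoeff2 (a b : ℝ) : ℝ :=
  a*(
    a^7 + 4*a^6*b + 5*a^6 + 5*a^5*b^2 + 15*a^5*b + 9*a^5 - 17*a^4*b^2 - 10*a^4*b + 8*a^4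
    - 5*a^3*b^4 - 44*a^3*b^3 - 134*a^3*b^2 - 67*a^3*b + 4*a^3 - 4*a^2*b^5 - 27*a^2*b^4
    - 68*a^2*b^3 - 119*a^2*b^2 - 40*a^2*b - a*b^6 - 11*a*b^5 - 31*a*b^4 - 41*a*b^3 - 32*a*b^2
    - 4*a*b - b^6 - 6*b^5 - 13*b^4 - 12*b^3 - 4*b^2)

/-- Coefficient of `γ^3` in the crossing polynomial. -/
def crossingCoeff3 (a b : ℝ) : ℝ :=
  2*a^7*b + 4*a^7 + 8*a^6*b^2 + 29*a^6*b + 22*a^6 + 12*a^5*b^3 + 72*a^5*b^2 + 101*a^5*b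
  + 46*a^5 + 8*a^4*b^4 + 58*a^4*b^3 + 168*a^4*b^2 + 160*a^4*b + 50*a^4 + 2*a^3*b^5
  + 12*a^3*b^4 + 41*a^3*b^3 + 124*a^3*b^2 + 137*a^3*b + 32*a^3 + a^2*b^5 + 13*a^2*b^4
  + 26*a^2*b^3 + 41*a^2*b^2 + 52*a^2*b + 8*a^2 + 6*a*b^5 + 22*a*b^4 + 23*a*b^3 + 8*a*b^2
  + 4*a*b + b^6 + 6*b^5 + 13*b^4 + 12*b^3 + 4*b^2

/-- Coefficient of `γ^4` in the crossing polynomial. -/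
def crossingCoeff4 (a b : ℝ) : ℝ :=
  a^6*b^2 + 7*a^6*b + 4*a^6 + 4*a^5*b^3 + 32*a^5*b^2 + 63*a^5*b + 24*a^5 + 6*a^4*b^4
  + 60*a^4*b^3 + 173*a^4*b^2 + 176*a^4*b + 52*a^4 + 4*a^3*b^5 + 50*a^3*b^4 + 205*a^3*b^3
  + 351*a^3*b^2 + 235*a^3*b + 48*a^3 + a^2*b^6 + 17*a^2*b^5 + 97*a^2*b^4 + 269*a^2*b^3
  + 337*a^2*b^2 + 166*a^2*b + 16*a^2 + 2*a*b^6 + 24*a*b^5 + 101*a*b^4 + 189*a*b^3 + 160*a*b^2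
  + 52*a*b + 2*b^6 + 15*b^5 + 43*b^4 + 58*b^3 + 36*b^2 + 8*b

/-- Coefficient of `γ^5` in the crossing polynomial. -/
def crossingCoeff5 (a b : ℝ) : ℝ :=
  4*a^5*b^2 + 11*a^5*b + 2*a^5 + 13*a^4*b^3 + 60*a^4*b^2 + 72*a^4*b + 10*a^4 + 15*a^3*b^4
  + 105*a^3*b^3 + 228*a^3*b^2 + 165*a^3*b + 16*a^3 + 7*a^2*b^5 + 71*a^2*b^4 + 252*a^2*b^3
  + 365*a^2*b^2 + 186*a^2*b + 8*a^2 + a*b^6 + 16*a*b^5 + 98*a*b^4 + 251*a*b^3 + 276*a*b^2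
  + 108*a*b + b^6 + 12*b^5 + 49*b^4 + 90*b^3 + 76*b^2 + 24*b

/-- Coefficient of `γ^6` in the crossing polynomial. -/
def crossingCoeff6 (a b : ℝ) : ℝ :=
  b*(a + b + 2)*(
    5*a^3*b + 7*a^3 + 8*a^2*b^2 + 33*a^2*b + 27*a^2 + 3*a*b^3 + 21*a*b^2 + 50*a*b + 32*a
    + 3*b^3 + 15*b^2 + 24*b + 12)

/-- Coefficient of `γ^7` in the crossing polynomial. -/
def crossingCoeff7 (a b : ℝ) : ℝ :=
  2*b*(a + b + 2)^2*(a + 1)*(b + 1)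

/-- The polynomial in `g` with the sign of the difference of the two throughputs. -/
def crossingPoly (a b g : ℝ) : ℝ :=
  -crossingCoeff0 a b - crossingCoeff1 a b*g + crossingCoeff2 a b*g^2 + crossingCoeff3 a b*g^3
    + crossingCoeff4 a b*g^4 + crossingCoeff5 a b*g^5 + crossingCoeff6 a b*g^6
    + crossingCoeff7 a b*g^7

lemma crossingPoly_one (a b : ℝ) :
    crossingPoly a b 1 = 2*(a + b + 1)*(a + b + 2)^3
      *(a^3 + 2*a^2*b + 2*a^2 + a*b^2 + 6*a*b + 2*b^2 + 4*b) := by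
  unfold crossingPoly crossingCoeff0 crossingCoeff1 crossingCoeff2 crossingCoeff3 crossingCoeff4
    crossingCoeff5 crossingCoeff6 crossingCoeff7
  ring

/-- A polynomial of degree at most seven whose coefficients change sign once, around the
quadratic one, has exactly one root in the unit interval if it is positive at `1`. -/
lemma existsUnique_root_of_one_sign_change {c₀ c₁ c₂ c₃ c₄ c₅ c₆ c₇ : ℝ} {f : ℝ → ℝ}
    (hf : ∀ x, f x = -c₀ - c₁*x + c₂*x^2 + c₃*x^3 + c₄*x^4 + c₅*x^5 + c₆*x^6 + c₇*x^7)
    (h₀ : 0 < c₀) (h₁ : 0 ≤ c₁) (h₃ : 0 ≤ c₃) (h₄ : 0 ≤ c₄) (h₅ : 0 ≤ c₅) (h₆ : 0 ≤ c₆)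
    (h₇ : 0 ≤ c₇) (hone : 0 < f 1) : ∃! x, x ∈ Ioo (0 : ℝ) 1 ∧ f x = 0 := by
  have hcont : Continuous f := by
    rw [funext hf]
    fun_prop
  obtain ⟨x, hx, hfx⟩ := intermediate_value_Ioo zero_le_one hcont.continuousOn
    (show (0 : ℝ) ∈ Ioo (f 0) (f 1) from ⟨by rw [hf]; simpa using h₀, hone⟩)
  have hne {y z : ℝ} (hy : 0 < y) (hyz : y < z) (hfy : f y = 0) : f z ≠ 0 := by
    intro hfz
    have hz := hy.trans hyz
    rw [hf] at hfy hfz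
    have hpow (n : ℕ) : 0 ≤ z^n - y^n := sub_nonneg.2 (pow_le_pow_left₀ hy.le hyz.le n)
    have hzy : 0 < z^2 - y^2 := sub_pos.2 (pow_lt_pow_left₀ hyz hy.le two_ne_zero)
    have key : c₀*(z^2 - y^2) + c₁*(y*z)*(z^1 - y^1)
        + (y*z)^2*(c₃*(z^1 - y^1) + c₄*(z^2 - y^2) + c₅*(z^3 - y^3) + c₆*(z^4 - y^4)
          + c₇*(z^5 - y^5)) = 0 := by
      linear_combination y^2*hfz - z^2*hfy
    have hp1 := hpow 1
    have hp3 := hpow 3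
    have hp4 := hpow 4
    have hp5 := hpow 5
    have : 0 < c₀*(z^2 - y^2) + c₁*(y*z)*(z^1 - y^1)
        + (y*z)^2*(c₃*(z^1 - y^1) + c₄*(z^2 - y^2) + c₅*(z^3 - y^3) + c₆*(z^4 - y^4)
          + c₇*(z^5 - y^5)) := by
      positivity
    exact this.ne' key
  refine ⟨x, ⟨hx, hfx⟩, fun y ⟨hy, hfy⟩ => ?_⟩
  rcases lt_trichotomy y x with h | h | h
  · exact absurd hfx (hne hy.1 h hfy)
  · exact h
  · exact absurd hfy (hne hx.1 h hfx)

lemma existsUnique_crossingPoly_root {a b : ℝ} (ha : 0 < a) (hb : 0 < b) :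
    ∃! g, g ∈ Ioo (0 : ℝ) 1 ∧ crossingPoly a b g = 0 := by
  refine existsUnique_root_of_one_sign_change (fun _ => rfl) ?_ ?_ ?_ ?_ ?_ ?_ ?_ ?_
  · unfold crossingCoeff0; positivity
  · unfold crossingCoeff1; positivity
  · unfold crossingCoeff3; positivity
  · unfold crossingCoeff4; positivity
  · unfold crossingCoeff5; positivity
  · unfold crossingCoeff6; positivity
  · unfold crossingCoeff7; positivity
  · rw [crossingPoly_one]; positivity

lemma throughput_sub_fullWeight_partialWeight {a b g : ℝ} (hg : 0 < g) :
    g*(((a + b)*(partialWeight a b g 1 1 + partialWeight a b g 1 2)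
          + b*(partialWeight a b g 0 1 + partialWeight a b g 0 2))
        *(∑ i, ∑ j, fullWeight a b g i j)
      - (a + b)*(fullWeight a b g 1 1 + fullWeight a b g 1 2 + fullWeight a b g 2 1
          + fullWeight a b g 2 2)*(∑ m, ∑ n, partialWeight a b g m n))
      = b*crossingPoly a b g := by
  have hg₁ : 1 + g ≠ 0 := by positivity
  simp only [Fin.sum_univ_succ, Fin.sum_univ_zero, fullWeight, partialWeight]
  simp
  unfold fullEmptyFactor fullDedicatedFactor fullOverflowFactor crossingPoly crossingCoeff0
    crossingCoeff1 crossingCoeff2 crossingCoeff3 crossingCoeff4 crossingCoeff5 crossingCoeff6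
    crossingCoeff7
  field_simp
  ring

lemma Tfs_eq_Tps_iff {ρ k g : ℝ} {π : Fin 3 → Fin 3 → ℝ} {p : Fin 2 → Fin 3 → ℝ} (hρ : 0 < ρ)
    (hk : 0 < k) (hg : 0 < g) (hπ : FullStationary ρ k g π) (hp : PartialStationary ρ k g p) :
    Tfs ρ k π = Tps ρ k p ↔ crossingPoly ρ (k*ρ) g = 0 := by
  have hb : 0 < k*ρ := by positivity
  have hW := sum_fullWeight_pos hρ hb hg
  have hV := sum_partialWeight_pos hρ hb hg
  have hw := hπ.mul_sum_fullWeight hρ hk hg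
  have hv := hp.mul_sum_partialWeight hρ hk hg
  have key := throughput_sub_fullWeight_partialWeight (a := ρ) (b := k*ρ) hg
  rw [← hw 1 1, ← hw 1 2, ← hw 2 1, ← hw 2 2, ← hv 1 1, ← hv 1 2, ← hv 0 1, ← hv 0 2] at key
  set W := ∑ i, ∑ j, fullWeight ρ (k*ρ) g i j
  set V := ∑ m, ∑ n, partialWeight ρ (k*ρ) g m n
  have hdiff : g*W*V*(Tfs ρ k π - Tps ρ k p) = k*ρ*crossingPoly ρ (k*ρ) g := by
    unfold Tfs Tps
    linear_combination key
  rw [← sub_eq_zero]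
  constructor <;> intro h <;> rw [h, mul_zero] at hdiff
  · exact (mul_eq_zero.1 hdiff.symm).resolve_left hb.ne'
  · exact (mul_eq_zero.1 hdiff).resolve_left (by positivity)

/-- there is a unique `γ ∈ (0,1)` at which the throughputs of the full and
partial flexibility systems coincide (the crossing value `γ^r`). -/
theorem stmt_8 (ρ k : ℝ) (hρ : 0 < ρ) (hk : k ∈ Set.Ioo (0:ℝ) 1) :
    ∃! γ : ℝ, γ ∈ Set.Ioo (0:ℝ) 1 ∧
      ∃ (π : Fin 3 → Fin 3 → ℝ) (p : Fin 2 → Fin 3 → ℝ),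
        FullStationary ρ k γ π ∧ PartialStationary ρ k γ p ∧ Tfs ρ k π = Tps ρ k p := by
  have hb : 0 < k*ρ := mul_pos hk.1 hρ
  refine (existsUnique_congr fun g => and_congr_right fun hg => ?_).1
    (existsUnique_crossingPoly_root hρ hb)
  constructor
  · intro h
    obtain ⟨π, hπ⟩ := exists_fullStationary hρ hk.1 hg.1
    obtain ⟨p, hp⟩ := exists_partialStationary hρ hk.1 hg.1
    exact ⟨π, p, hπ, hp, (Tfs_eq_Tps_iff hρ hk.1 hg.1 hπ hp).2 h⟩
  · rintro ⟨π, p, hπ, hp, h⟩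
    exact (Tfs_eq_Tps_iff hρ hk.1 hg.1 hπ hp).1 h
end

section
/- Let ρ > 0 and k ∈ (0,1). Suppose γ^b ∈ (0,1) is such that some stationary distribution π_b of the full flexibility system with parameters (ρ, k, γ^b) satisfies T_fs(π_b) = T_is, and suppose γ^r ∈ (0,1) is such that some stationary distributions π_r (full flexibility) and p_r (partial flexibility) with parameters (ρ, k, γ^r) satisfy T_fs(π_r) = T_ps(p_r). Then 0 < kρ/(kρ+1) < γ^b < γ^r < ρ/(ρ+1). -/
/-- The coefficients of `fullLoss a b x 1` as a polynomial in `x`. -/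
def fullLossCoeff (a b : ℝ) : ℕ → ℝ
  | 0 => a^4*b + 3*a^3*b^2 + 2*a^3*b + 3*a^2*b^3 + a*b^4 + 2*a*b^3
  | 1 => a^5 + 4*a^4*b + 2*a^4 + 7*a^3*b^2 + 3*a^3*b + 7*a^2*b^3 + 14*a^2*b^2 + 2*a^2*b +
    4*a*b^4 + 3*a*b^3 + 2*a*b^2 + b^5 + 2*b^4
  | 2 => a^5 + 4*a^4*b + 5*a^4 + 7*a^3*b^2 + 19*a^3*b + 6*a^3 + 7*a^2*b^3 + 16*a^2*b^2 + 6*a^2*b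
    + 4*a*b^4 + 19*a*b^3 + 6*a*b^2 + b^5 + 5*b^4 + 6*b^3
  | 3 => a^4*b + 3*a^4 + 3*a^3*b^2 + 13*a^3*b + 8*a^3 + 3*a^2*b^3 + 24*a^2*b^2 + 24*a^2*b +
    4*a^2 + a*b^4 + 13*a*b^3 + 24*a*b^2 + 4*a*b + 3*b^4 + 8*b^3 + 4*b^2
  | 4 => 3*a^3*b + 2*a^3 + 6*a^2*b^2 + 14*a^2*b + 4*a^2 + 3*a*b^3 + 14*a*b^2 + 8*a*b + 2*b^3 +
    4*b^2
  | 5 => 2*a^2*b + 2*a*b^2 + 4*a*b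
  | _ => 0

/-- The coefficients of `fullServed a b x 1` as a polynomial in `x`. -/
def fullServedCoeff (a b : ℝ) : ℕ → ℝ
  | 0 => 0
  | 1 => a^4 + 4*a^3*b + 2*a^3 + 6*a^2*b^2 + 2*a^2*b + 4*a*b^3 + 2*a*b^2 + b^4 + 2*b^3
  | 2 => 2*a^4 + 8*a^3*b + 9*a^3 + 12*a^2*b^2 + 27*a^2*b + 11*a^2 + 8*a*b^3 + 27*a*b^2 + 10*a*b
    + 2*a + 2*b^4 + 9*b^3 + 11*b^2 + 2*b
  | 3 => a^4 + 4*a^3*b + 10*a^3 + 6*a^2*b^2 + 34*a^2*b + 24*a^2 + 4*a*b^3 + 34*a*b^2 + 56*a*b +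
    18*a + b^4 + 10*b^3 + 24*b^2 + 18*b + 4
  | 4 => 3*a^3 + 9*a^2*b + 15*a^2 + 9*a*b^2 + 34*a*b + 22*a + 3*b^3 + 15*b^2 + 22*b + 8
  | 5 => 2*a^2 + 4*a*b + 6*a + 2*b^2 + 6*b + 4
  | _ => 0

/-- Up to normalization, the stationary loss rate of the full flexibility system with arrival rates
`a`, `b` and prolonged coefficient `x / y`, as a form in `x`, `y`. -/
def fullLoss (a b x y : ℝ) : ℝ :=
  fullLossCoeff a b 0 * y^5 + fullLossCoeff a b 1 * x * y^4 + fullLossCoeff a b 2 * x^2 * y^3 +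
  fullLossCoeff a b 3 * x^3 * y^2 + fullLossCoeff a b 4 * x^4 * y + fullLossCoeff a b 5 * x^5

/-- Up to the same normalization as `fullLoss`, the throughput of the full flexibility system. -/
def fullServed (a b x y : ℝ) : ℝ :=
  fullServedCoeff a b 1 * x * y^4 + fullServedCoeff a b 2 * x^2 * y^3 +
  fullServedCoeff a b 3 * x^3 * y^2 + fullServedCoeff a b 4 * x^4 * y + fullServedCoeff a b 5 * x^5

/-- Up to normalization, the stationary loss rate of the partial flexibility system with arrival
rates `a`, `b` and prolonged coefficient `x / y`, as a form in `x`, `y`. -/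
def partialLoss (a b x y : ℝ) : ℝ :=
  a^5*y^2 + a^4*b*x*y + 2*a^4*b*y^2 + a^4*x*y + 2*a^4*y^2 + 2*a^3*b^2*x*y + a^3*b^2*y^2 +
  a^3*b*x^2 + 6*a^3*b*x*y + 3*a^3*b*y^2 + 2*a^3*x*y + a^2*b^3*x*y + 2*a^2*b^2*x^2 +
  7*a^2*b^2*x*y + a^2*b^2*y^2 + 2*a^2*b*x^2 + 4*a^2*b*x*y + 2*a^2*b*y^2 + a*b^3*x^2 +
  2*a*b^3*x*y + 3*a*b^2*x^2 + 7*a*b^2*x*y + b^3*x^2 + b^3*x*y + 2*b^2*x^2 + 2*b^2*x*y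

/-- Up to the same normalization as `partialLoss`, the throughput of the partial flexibility
system. -/
def partialServed (a b x y : ℝ) : ℝ :=
  a^4*x*y + a^4*y^2 + 3*a^3*b*x*y + a^3*b*y^2 + a^3*x^2 + 5*a^3*x*y + 2*a^3*y^2 +
  2*a^2*b^2*x*y + 3*a^2*b*x^2 + 12*a^2*b*x*y + 3*a^2*x^2 + 7*a^2*x*y + 2*a*b^2*x^2 +
  3*a*b^2*x*y + 6*a*b*x^2 + 10*a*b*x*y + 2*a*x^2 + 2*a*x*y + b^2*x^2 + b^2*x*y + 2*b*x^2 +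
  2*b*x*y

/-- Up to normalization, the loss rate of the independent system. -/
def indepLoss (a b : ℝ) : ℝ := a^2*(b + 1) + b^2*(a + 1)

/-- Up to the same normalization as `indepLoss`, the throughput of the independent system. -/
def indepServed (a b : ℝ) : ℝ := a*(b + 1) + b*(a + 1)

section Positivity

variable {a b x y : ℝ}

lemma fullLoss_pos (ha : 0 < a) (hb : 0 < b) (hx : 0 < x) (hy : 0 < y) :
    0 < fullLoss a b x y := by
  simp only [fullLoss, fullLossCoeff]; positivity

lemma partialLoss_pos (ha : 0 < a) (hb : 0 < b) (hx : 0 < x) (hy : 0 < y) :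
    0 < partialLoss a b x y := by
  unfold partialLoss; positivity

lemma indepLoss_pos (ha : 0 < a) (hb : 0 < b) : 0 < indepLoss a b := by
  unfold indepLoss; positivity

end Positivity

section Homogeneity

variable (a b g y : ℝ)

lemma fullLoss_mul : fullLoss a b (g*y) y = y^5 * fullLoss a b g 1 := by
  simp only [fullLoss, fullLossCoeff]; ring

lemma fullServed_mul : fullServed a b (g*y) y = y^5 * fullServed a b g 1 := by
  simp only [fullServed, fullServedCoeff]; ring

lemma partialLoss_mul : partialLoss a b (g*y) y = y^2 * partialLoss a b g 1 := by
  unfold partialLoss; ring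

lemma partialServed_mul : partialServed a b (g*y) y = y^2 * partialServed a b g 1 := by
  unfold partialServed; ring

end Homogeneity

section Throughput

variable {ρ k γ : ℝ}

lemma FullStationary.tfs_mul {π : Fin 3 → Fin 3 → ℝ} (h : FullStationary ρ k γ π) (hγ : 0 < γ) :
    Tfs ρ k π * (fullLoss ρ (k*ρ) γ 1 + fullServed ρ (k*ρ) γ 1) =
      (ρ + k*ρ) * fullServed ρ (k*ρ) γ 1 := by
  obtain ⟨-, hsum, -, e10, e20, e01, e11, e21, e02, e12, e22⟩ := h
  simp only [Fin.sum_univ_three] at hsum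
  rw [show Tfs ρ k π = (ρ + k*ρ) * (1 - (π 1 1 + π 1 2 + π 2 1 + π 2 2)) by unfold Tfs; ring]
  generalize k*ρ = b at *
  generalize ρ = a at *
  generalize γ = g at *
  generalize π 0 0 = z at *
  generalize π 1 0 = p at *
  generalize π 0 2 = q at *
  generalize π 2 0 = r at *
  generalize π 0 1 = s at *
  generalize π 1 1 = d11 at *
  generalize π 1 2 = d12 at *
  generalize π 2 1 = d21 at *
  generalize π 2 2 = d22 at *
  have hl : 2*g*(1 + g)*(d11 + d12 + d21 + d22) =
      2*g*a*(p + s) + g*(1 + g)*(a*q + b*p) + (1 + g)*(a*r + b*s) + 2*g*b*(r + q) := by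
    linear_combination 2*g*e11 + g*(1 + g)*e12 + (1 + g)*e21 + 2*g*e22
  have hr : 2*(1 + g)*((a + b + g)*r) = (1 + g)*(a*r + b*s) + 2*b*(r + q) := by
    linear_combination 2*(1 + g)*e20 + (1 + g)*e21 + 2*e22
  have hs : 2*(1 + g)*((a + b + g)*s) = 2*a*(p + s) + (1 + g)*(a*r + b*s) := by
    linear_combination 2*(1 + g)*e01 + 2*e11 + (1 + g)*e21
  have hp : 2*(1 + g)*((a + b + 1)*p) =
      2*(1 + g)*(a*z) + 2*g*a*(p + s) + (1 + g)*(a*q + b*p) := by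
    linear_combination 2*(1 + g)*e10 + 2*g*e11 + (1 + g)*e12
  have hq : 2*(1 + g)*((a + b + 1)*q) =
      2*(1 + g)*(b*z) + (1 + g)*(a*q + b*p) + 2*g*b*(r + q) := by
    linear_combination 2*(1 + g)*e02 + (1 + g)*e12 + 2*g*e22
  have hbal : fullServed a b g 1 *
      (2*g*a*(p + s) + g*(1 + g)*(a*q + b*p) + (1 + g)*(a*r + b*s) + 2*g*b*(r + q)) =
      fullLoss a b g 1 * (2*g*(1 + g)*(z + p + q + r + s)) := by
    simp only [fullLoss, fullServed, fullLossCoeff, fullServedCoeff]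
    linear_combination
      (a^4*g^2 + a^4*g - a^3*b*g^4 + 5*a^3*b*g^2 + 4*a^3*b*g - a^3*g^4 + 3*a^3*g^3 + 6*a^3*g^2 +
      2*a^3*g - 2*a^2*b^2*g^4 + a^2*b^2*g^3 + 8*a^2*b^2*g^2 + 5*a^2*b^2*g - 5*a^2*b*g^4 +
      8*a^2*b*g^3 + 24*a^2*b*g^2 + 3*a^2*b*g - a^2*g^4 + 8*a^2*g^3 + 9*a^2*g^2 - a*b^3*g^4 +
      2*a*b^3*g^3 + 5*a*b^3*g^2 + 2*a*b^3*g - 2*a*b^2*g^5 + 16*a*b^2*g^3 + 11*a*b^2*g^2 +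
      5*a*b^2*g - 2*a*b*g^5 + 3*a*b*g^4 + 20*a*b*g^3 + 9*a*b*g^2 + 2*a*b*g + 2*a*g^4 + 4*a*g^3 +
      2*a*g^2 + b^4*g^3 + b^4*g^2 + 2*b^3*g^4 + 5*b^3*g^3 + 3*b^3*g^2 + 6*b^2*g^4 + 8*b^2*g^3 +
      2*b^2*g^2 + 4*b*g^4 + 4*b*g^3) * hr +
      (a^4*g^3 + a^4*g^2 - a^3*b*g^4 + 2*a^3*b*g^3 + 5*a^3*b*g^2 + 2*a^3*b*g + 2*a^3*g^4 +
      5*a^3*g^3 + 3*a^3*g^2 - 2*a^2*b^2*g^4 + a^2*b^2*g^3 + 8*a^2*b^2*g^2 + 5*a^2*b^2*g -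
      2*a^2*b*g^5 + 16*a^2*b*g^3 + 11*a^2*b*g^2 + 5*a^2*b*g + 6*a^2*g^4 + 8*a^2*g^3 + 2*a^2*g^2 -
      a*b^3*g^4 + 5*a*b^3*g^2 + 4*a*b^3*g - 5*a*b^2*g^4 + 8*a*b^2*g^3 + 24*a*b^2*g^2 + 3*a*b^2*g -
      2*a*b*g^5 + 3*a*b*g^4 + 20*a*b*g^3 + 9*a*b*g^2 + 2*a*b*g + 4*a*g^4 + 4*a*g^3 + b^4*g^2 +
      b^4*g - b^3*g^4 + 3*b^3*g^3 + 6*b^3*g^2 + 2*b^3*g - b^2*g^4 + 8*b^2*g^3 + 9*b^2*g^2 +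
      2*b*g^4 + 4*b*g^3 + 2*b*g^2) * hs +
      (a^4*g^3 + a^4*g^2 + 3*a^3*b*g^3 + 4*a^3*b*g^2 + a^3*b*g + 3*a^3*g^4 + 5*a^3*g^3 + 2*a^3*g^2
      + a^2*b^2*g^4 + 4*a^2*b^2*g^3 + 5*a^2*b^2*g^2 + 2*a^2*b^2*g + 8*a^2*b*g^4 + 17*a^2*b*g^3 +
      3*a^2*b*g^2 + 2*a^2*b*g + 2*a^2*g^5 + 8*a^2*g^4 + 6*a^2*g^3 + 2*a*b^3*g^4 + 3*a*b^3*g^3 +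
      2*a*b^3*g^2 + a*b^3*g + 3*a*b^2*g^5 + 12*a*b^2*g^4 + 8*a*b^2*g^3 + 7*a*b^2*g^2 + 7*a*b*g^5 +
      18*a*b*g^4 + 5*a*b*g^3 + 2*a*b*g^2 + 4*a*g^5 + 4*a*g^4 + b^4*g^4 + b^4*g^3 + 3*b^3*g^5 +
      5*b^3*g^4 + 2*b^3*g^3 + 2*b^2*g^6 + 7*b^2*g^5 + 6*b^2*g^4 + b^2*g^3 + 2*b*g^6 + 4*b*g^5 +
      2*b*g^4) * hp +
      (a^4*g^4 + a^4*g^3 + 2*a^3*b*g^4 + 3*a^3*b*g^3 + 2*a^3*b*g^2 + a^3*b*g + 3*a^3*g^5 +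
      5*a^3*g^4 + 2*a^3*g^3 + a^2*b^2*g^4 + 4*a^2*b^2*g^3 + 5*a^2*b^2*g^2 + 2*a^2*b^2*g +
      3*a^2*b*g^5 + 12*a^2*b*g^4 + 8*a^2*b*g^3 + 7*a^2*b*g^2 + 2*a^2*g^6 + 7*a^2*g^5 + 6*a^2*g^4 +
      a^2*g^3 + 3*a*b^3*g^3 + 4*a*b^3*g^2 + a*b^3*g + 8*a*b^2*g^4 + 17*a*b^2*g^3 + 3*a*b^2*g^2 +
      2*a*b^2*g + 7*a*b*g^5 + 18*a*b*g^4 + 5*a*b*g^3 + 2*a*b*g^2 + 2*a*g^6 + 4*a*g^5 + 2*a*g^4 +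
      b^4*g^3 + b^4*g^2 + 3*b^3*g^4 + 5*b^3*g^3 + 2*b^3*g^2 + 2*b^2*g^5 + 8*b^2*g^4 + 6*b^2*g^3 +
      4*b*g^5 + 4*b*g^4) * hq
  have key : 2*g*(1 + g) * ((fullLoss a b g 1 + fullServed a b g 1) * (d11 + d12 + d21 + d22)) =
      2*g*(1 + g) * fullLoss a b g 1 := by
    linear_combination fullServed a b g 1 * hl + hbal +
      fullLoss a b g 1 * (2*g*(1 + g)) * hsum
  have hg : 2*g*(1 + g) ≠ 0 := by positivity
  linear_combination -(a + b) * mul_left_cancel₀ hg key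

lemma PartialStationary.tps_mul {p : Fin 2 → Fin 3 → ℝ} (h : PartialStationary ρ k γ p)
    (hρ : 0 < ρ) (hk : 0 < k) :
    Tps ρ k p * (partialLoss ρ (k*ρ) γ 1 + partialServed ρ (k*ρ) γ 1) =
      (ρ + k*ρ) * partialServed ρ (k*ρ) γ 1 := by
  obtain ⟨-, hsum, -, e10, e12, e02, e11, e01⟩ := h
  have hb : 0 < k*ρ := by positivity
  simp only [Fin.sum_univ_two, Fin.sum_univ_three] at hsum
  unfold Tps
  generalize k*ρ = b at *
  generalize ρ = a at *
  generalize γ = g at *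
  generalize p 0 0 = z at *
  generalize p 1 0 = r at *
  generalize p 0 2 = q at *
  generalize p 0 1 = s at *
  generalize p 1 1 = d1 at *
  generalize p 1 2 = d2 at *
  obtain ⟨c, rfl⟩ : ∃ c, s = a^2*(a + b + 2) * c :=
    ⟨s / (a^2*(a + b + 2)), by field_simp⟩
  have hd1 : d1 = (a + g) * (a^2*(a + b + 2)) * c := by linear_combination -e01
  have hr : r = g*(1 + a + g)*(a*(a + b + 2)) * c := by
    refine mul_left_cancel₀ hρ.ne' ?_
    linear_combination (1 + g)*hd1 - e11
  have hq : (a + 2)*q = 2*b*z + b*r := by linear_combination 2*e02 + e12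
  have hz : z = (2*a^2*g + a*b*g + a*g^2 + 5*a*g + b*g^2 + b*g + 2*g^2 + 2*g) * c := by
    have h0 : 2*a*(a + 2 + b) ≠ 0 := by positivity
    refine mul_left_cancel₀ h0 ?_
    linear_combination -2*(a + 2)*e10 - (a + 2)*e12 - a*hq - 2*g*(a + 2)*hd1 +
      ((a + 2)*(2*(a + b + 1) - b) - a*b)*hr
  have hq' : q = (a^2*b*g + a*b^2*g + a*b*g^2 + 5*a*b*g + b^2*g^2 + b^2*g + 2*b*g^2 +
      2*b*g) * c := by
    have h0 : a + 2 ≠ 0 := by positivity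
    refine mul_left_cancel₀ h0 ?_
    linear_combination hq + 2*b*hz + b*hr
  have hd2 : d2 = (a^3*b*g + a^2*b^2*g + a^2*b*g^2 + 4*a^2*b*g + a*b^2*g^2 + a*b^2*g + 2*a*b*g^2 +
      2*a*b*g) * c := by
    linear_combination e12/2 + a/2*hq' + b/2*hr
  have hmass : (partialLoss a b g 1 + partialServed a b g 1) * c = a + b := by
    unfold partialLoss partialServed
    rw [hz, hr, hq', hd1, hd2] at hsum
    linear_combination (a + b) * hsum
  have hloss : a*(d1 + d2) + b*(d1 + d2 + a^2*(a + b + 2)*c + q) = partialLoss a b g 1 * c := by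
    rw [hd1, hd2, hq']
    unfold partialLoss
    ring
  linear_combination -(partialLoss a b g 1 + partialServed a b g 1) * hloss -
    partialLoss a b g 1 * hmass

lemma tis_mul (hρ : 0 < ρ) (hk : 0 < k) :
    Tis ρ k * (indepLoss ρ (k*ρ) + indepServed ρ (k*ρ)) = (ρ + k*ρ) * indepServed ρ (k*ρ) := by
  unfold Tis indepLoss indepServed
  field_simp
  ring

end Throughput

section Comparison

variable {a b g h : ℝ}

lemma indep_lt_partial (ha : 0 < a) (hb : 0 < b) (hg : 0 < g) (h : b < g * (b + 1)) :
    indepServed a b * partialLoss a b g 1 < partialServed a b g 1 * indepLoss a b := by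
  rw [← sub_pos]
  have key : partialServed a b g 1 * indepLoss a b - indepServed a b * partialLoss a b g 1 =
      (g*(b + 1) - b) * ((a + b) *
        (a^5 + a^4*b + a^4*g + 4*a^4 + a^3*b*g + 2*a^3*b + 3*a^3*g + 5*a^3 +
        a^2*b*g + a^2*b + 2*a^2*g + 2*a^2)) := by
    unfold partialServed indepLoss indepServed partialLoss
    ring
  rw [key]
  exact mul_pos (by linarith) (by positivity)

set_option maxRecDepth 20000 in
set_option maxHeartbeats 4000000 in
lemma full_lt_indep_shifted {b c d : ℝ} (hb : 0 < b) (hc : 0 ≤ c) (hd : 0 < d) :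
    0 < indepServed (b + d) b * fullLoss (b + d) b b (b + 1 + c) -
      fullServed (b + d) b b (b + 1 + c) * indepLoss (b + d) b := by
  simp only [indepServed, fullLoss, fullServed, indepLoss, fullLossCoeff, fullServedCoeff]
  ring_nf
  positivity

lemma full_lt_indep (hb : 0 < b) (hab : b < a) (hg : 0 < g) (h : g * (b + 1) ≤ b) :
    fullServed a b g 1 * indepLoss a b < indepServed a b * fullLoss a b g 1 := by
  have hc : 0 ≤ b/g - (b + 1) := by
    rw [sub_nonneg, le_div_iff₀ hg]; linarith
  have hy : 0 < b/g := by positivity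
  have hb' : g*(b/g) = b := by field_simp
  have hlt := full_lt_indep_shifted hb hc (sub_pos.2 hab)
  rw [add_sub_cancel, add_sub_cancel] at hlt
  have hL := fullLoss_mul a b g (b/g)
  have hS := fullServed_mul a b g (b/g)
  rw [hb'] at hL hS
  rw [hL, hS] at hlt
  refine lt_of_mul_lt_mul_left (a := (b/g)^5) ?_ (by positivity)
  linarith

set_option maxRecDepth 20000 in
set_option maxHeartbeats 4000000 in
lemma full_lt_partial_shifted {b c d : ℝ} (hb : 0 < b) (hc : 0 ≤ c) (hd : 0 < d) :
    0 < partialServed (b + d) b b (b + 1 + c) * fullLoss (b + d) b b (b + 1 + c) -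
      fullServed (b + d) b b (b + 1 + c) * partialLoss (b + d) b b (b + 1 + c) := by
  simp only [partialServed, fullLoss, fullServed, partialLoss, fullLossCoeff, fullServedCoeff]
  ring_nf
  positivity

lemma full_lt_partial (hb : 0 < b) (hab : b < a) (hg : 0 < g) (h : g * (b + 1) ≤ b) :
    fullServed a b g 1 * partialLoss a b g 1 < partialServed a b g 1 * fullLoss a b g 1 := by
  have hc : 0 ≤ b/g - (b + 1) := by
    rw [sub_nonneg, le_div_iff₀ hg]; linarith
  have hy : 0 < b/g := by positivity
  have hb' : g*(b/g) = b := by field_simp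
  have hlt := full_lt_partial_shifted hb hc (sub_pos.2 hab)
  rw [add_sub_cancel, add_sub_cancel] at hlt
  have hL := fullLoss_mul a b g (b/g)
  have hS := fullServed_mul a b g (b/g)
  have hL' := partialLoss_mul a b g (b/g)
  have hS' := partialServed_mul a b g (b/g)
  rw [hb'] at hL hS hL' hS'
  rw [hL, hS, hL', hS'] at hlt
  refine lt_of_mul_lt_mul_left (a := (b/g)^7) ?_ (by positivity)
  linarith

set_option maxRecDepth 20000 in
set_option maxHeartbeats 4000000 in
lemma partial_lt_full_shifted {b c d : ℝ} (hb : 0 < b) (hc : 0 ≤ c) (hd : 0 < d) :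
    0 < fullServed (b + d) b (b + d + c) (b + d + 1) *
        partialLoss (b + d) b (b + d + c) (b + d + 1) -
      partialServed (b + d) b (b + d + c) (b + d + 1) *
        fullLoss (b + d) b (b + d + c) (b + d + 1) := by
  simp only [partialServed, fullLoss, fullServed, partialLoss, fullLossCoeff, fullServedCoeff]
  ring_nf
  positivity

lemma partial_lt_full (hb : 0 < b) (hab : b < a) (h : a ≤ g * (a + 1)) :
    partialServed a b g 1 * fullLoss a b g 1 < fullServed a b g 1 * partialLoss a b g 1 := by
  have ha : 0 < a := hb.trans hab
  have hlt := partial_lt_full_shifted hb (sub_nonneg.2 h) (sub_pos.2 hab)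
  rw [add_sub_cancel, add_sub_cancel, fullServed_mul, fullLoss_mul, partialServed_mul,
    partialLoss_mul] at hlt
  refine lt_of_mul_lt_mul_left (a := (a + 1)^7) ?_ (by positivity)
  linarith

/-- If the minors `d i * e j - d j * e i`, `i < j`, are positive, then the quotient of the quintics
with coefficients `e` and `d` is strictly increasing on the positive half-line. -/
lemma quintic_mul_lt_of_minors_pos {d e : ℕ → ℝ} {g h : ℝ} (hg : 0 < g) (hgh : g < h)
    (hde : ∀ j ≤ 5, ∀ i < j, 0 < d i * e j - d j * e i) :
    (∑ i ∈ Finset.range 6, e i * g^i) * (∑ i ∈ Finset.range 6, d i * h^i) <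
      (∑ i ∈ Finset.range 6, e i * h^i) * (∑ i ∈ Finset.range 6, d i * g^i) := by
  have hpow : ∀ j, ∀ i < j, 0 < g^i * h^j - g^j * h^i := by
    intro j i hij
    obtain ⟨n, rfl⟩ := Nat.exists_eq_add_of_lt hij
    have hlt : g^(n + 1) < h^(n + 1) := pow_lt_pow_left₀ hgh hg.le n.succ_ne_zero
    have hpos : 0 < g^i * h^i := mul_pos (pow_pos hg i) (pow_pos (hg.trans hgh) i)
    linear_combination (g^i * h^i) * hlt
  have hsum : 0 < ∑ j ∈ Finset.Icc 1 5, ∑ i ∈ Finset.range j,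
      (d i * e j - d j * e i) * (g^i * h^j - g^j * h^i) := by
    refine Finset.sum_pos (fun j hj ↦ ?_) (by simp)
    rw [Finset.mem_Icc] at hj
    refine Finset.sum_pos (fun i hi ↦ ?_) (by simp; omega)
    rw [Finset.mem_range] at hi
    exact mul_pos (hde j hj.2 i hi) (hpow j i hi)
  rw [← sub_pos]
  convert hsum using 1
  simp [show Finset.Icc 1 5 = {1, 2, 3, 4, 5} from rfl, Finset.sum_range_succ]
  ring

lemma fullCoeff_minor_pos (ha : 0 < a) (hb : 0 < b) :
    ∀ j ≤ 5, ∀ i < j, 0 < fullLossCoeff a b i * fullServedCoeff a b j -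
      fullLossCoeff a b j * fullServedCoeff a b i := by
  intro j hj i hi
  interval_cases j <;> interval_cases i <;> simp only [fullLossCoeff, fullServedCoeff] <;>
    ring_nf <;> positivity

lemma full_strictMono (ha : 0 < a) (hb : 0 < b) (hg : 0 < g) (hgh : g < h) :
    fullServed a b g 1 * fullLoss a b h 1 < fullServed a b h 1 * fullLoss a b g 1 := by
  have hD (x : ℝ) : fullLoss a b x 1 = ∑ i ∈ Finset.range 6, fullLossCoeff a b i * x^i := by
    simp only [Finset.sum_range_succ, Finset.sum_range_zero, fullLoss]
    ring
  have hE (x : ℝ) : fullServed a b x 1 = ∑ i ∈ Finset.range 6, fullServedCoeff a b i * x^i := by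
    simp only [Finset.sum_range_succ, Finset.sum_range_zero, fullServed, fullServedCoeff]
    ring
  rw [hD, hD, hE, hE]
  exact quintic_mul_lt_of_minors_pos hg hgh (fullCoeff_minor_pos ha hb)

end Comparison

/-- the crossing values satisfy `0 < kρ/(kρ+1) < γ^b < γ^r < ρ/(ρ+1)`. -/
theorem stmt_14 (ρ k : ℝ) (hρ : 0 < ρ) (hk : k ∈ Set.Ioo (0:ℝ) 1)
    (γb γr : ℝ) (hγb : γb ∈ Set.Ioo (0:ℝ) 1) (hγr : γr ∈ Set.Ioo (0:ℝ) 1)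
    (hb : ∃ πb : Fin 3 → Fin 3 → ℝ, FullStationary ρ k γb πb ∧ Tfs ρ k πb = Tis ρ k)
    (hr : ∃ (πr : Fin 3 → Fin 3 → ℝ) (pr : Fin 2 → Fin 3 → ℝ),
      FullStationary ρ k γr πr ∧ PartialStationary ρ k γr pr ∧ Tfs ρ k πr = Tps ρ k pr) :
    0 < k*ρ/(k*ρ + 1) ∧ k*ρ/(k*ρ + 1) < γb ∧ γb < γr ∧ γr < ρ/(ρ + 1) := by
  obtain ⟨hk0, hk1⟩ := hk
  obtain ⟨hγb0, -⟩ := hγb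
  obtain ⟨hγr0, -⟩ := hγr
  obtain ⟨πb, hπb, hTb⟩ := hb
  obtain ⟨πr, pr, hπr, hpr, hTr⟩ := hr
  have hb0 : 0 < k*ρ := by positivity
  have hba : k*ρ < ρ := by nlinarith
  have cross {T s₁ l₁ s₂ l₂ : ℝ} (h₁ : T * (l₁ + s₁) = (ρ + k*ρ) * s₁)
      (h₂ : T * (l₂ + s₂) = (ρ + k*ρ) * s₂) : s₁ * l₂ = s₂ * l₁ := by
    have hL : ρ + k*ρ ≠ 0 := by positivity
    refine mul_left_cancel₀ hL ?_
    linear_combination (l₁ + s₁) * h₂ - (l₂ + s₂) * h₁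
  have hb_eq := cross (hTb ▸ hπb.tfs_mul hγb0) (tis_mul hρ hk0)
  have hr_eq := cross (hTr ▸ hπr.tfs_mul hγr0) (hpr.tps_mul hρ hk0)
  have hγb1 : k*ρ < γb * (k*ρ + 1) := by
    by_contra! hle
    exact (full_lt_indep hb0 hba hγb0 hle).ne hb_eq
  have hγr1 : k*ρ < γr * (k*ρ + 1) := by
    by_contra! hle
    exact (full_lt_partial hb0 hba hγr0 hle).ne hr_eq
  refine ⟨by positivity, (div_lt_iff₀ (by positivity)).2 hγb1, ?_,
    (lt_div_iff₀ (by positivity)).2 ?_⟩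
  · by_contra! hle
    have hmono : fullServed ρ (k*ρ) γr 1 * fullLoss ρ (k*ρ) γb 1 ≤
        fullServed ρ (k*ρ) γb 1 * fullLoss ρ (k*ρ) γr 1 := by
      rcases hle.eq_or_lt with rfl | hlt
      · rfl
      · exact (full_strictMono hρ hb0 hγr0 hlt).le
    have hlt := indep_lt_partial hρ hb0 hγr0 hγr1
    have hDb := fullLoss_pos hρ hb0 hγb0 one_pos
    have hDr := fullLoss_pos hρ hb0 hγr0 one_pos
    have hPl := partialLoss_pos hρ hb0 hγr0 one_pos
    have hIl := indepLoss_pos hρ hb0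
    have h₁ := mul_le_mul_of_nonneg_right hmono (mul_pos hPl hIl).le
    have h₂ := mul_lt_mul_of_pos_right hlt (mul_pos hDr hDb)
    refine h₂.not_ge ?_
    linear_combination h₁ - fullLoss ρ (k*ρ) γb 1 * indepLoss ρ (k*ρ) * hr_eq +
      fullLoss ρ (k*ρ) γr 1 * partialLoss ρ (k*ρ) γr 1 * hb_eq
  · by_contra! hle
    exact (partial_lt_full hb0 hba hle).ne hr_eq.symm
end
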